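/- arXiv:1511.00152 — 2 statements merged into one kernel-verified Lean document; each statement's English description precedes it below -/
import Mathlib

section
/- Let x₁, x₂ ∈ ℝ^p, let H ∈ ℝ^{p×p} be an orthogonal matrix all of whose entries have absolute value 1/√p (e.g., a normalized Hadamard matrix), let D = diag(ε) with ε ∈ {−1,+1}^p having i.i.d. uniform random sign entries, and let R ∈ ℝ^{p×m} be a sampling matrix whose m columns are chosen uniformly at random from the set of p canonical basis vectors of ℝ^p without replacement (independent of D). Suppose β > 1 satisfies 4·[√β + √(8·log(βp))]²·log(β) ≤ m ≤ p. Then with probability at least 1 − 3β⁻¹: 0.40·‖x₁ − x₂‖₂ ≤ ‖√(p/m)·Rᵀ H D (x₁ − x₂)‖₂ ≤ 1.48·‖x₁ − x₂‖₂. -/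
open Matrix Finset

/-- Probability of event `A` under the uniform distribution on the finite type `Ω`. -/
noncomputable def probOf {Ω : Type*} [Fintype Ω] (A : Set Ω) : ℝ :=
  (A.ncard : ℝ) / Fintype.card Ω

/-- Expectation of `f` under the uniform distribution on the finite type `Ω`. -/
noncomputable def expec {Ω E : Type*} [Fintype Ω] [AddCommMonoid E] [Module ℝ E]
    (f : Ω → E) : E :=
  (Fintype.card Ω : ℝ)⁻¹ • ∑ ω, f ω

/-- Euclidean norm of a vector. -/
noncomputable def l2norm {ι : Type*} [Fintype ι] (v : ι → ℝ) : ℝ :=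
  Real.sqrt (∑ i, v i ^ 2)

/-- Random sign vector `ε ∈ {±1}^p` built from boolean coin flips. -/
def signVec {p : ℕ} (ω : Fin p → Bool) : Fin p → ℝ := fun i => if ω i then 1 else -1

/-- The diagonal random sign matrix `D = diag(ε)`. -/
noncomputable def signMatrix {p : ℕ} (ω : Fin p → Bool) : Matrix (Fin p) (Fin p) ℝ :=
  Matrix.diagonal (signVec ω)

/-- Sampling matrix `R ∈ ℝ^{p×m}` whose `j`-th column is the canonical basis vector `e_{σ j}`;
a uniformly random `σ : Fin m ↪ Fin p` models choosing `m` distinct canonical basis vectors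
uniformly at random without replacement. -/
noncomputable def sampMatrix {p m : ℕ} (σ : Fin m ↪ Fin p) : Matrix (Fin p) (Fin m) ℝ :=
  Matrix.of fun i j => if σ j = i then 1 else 0

/-- Spectral norm (ℓ²→ℓ² operator norm) of a square matrix. -/
noncomputable def specNorm {p : ℕ} (A : Matrix (Fin p) (Fin p) ℝ) : ℝ :=
  ‖LinearMap.toContinuousLinearMap (Matrix.toEuclideanLin A)‖

/-- `diag(A)`: the matrix obtained by zeroing all off-diagonal entries of `A`. -/
noncomputable def diagPart {p : ℕ} (A : Matrix (Fin p) (Fin p) ℝ) : Matrix (Fin p) (Fin p) ℝ :=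
  Matrix.diagonal A.diag


lemma aux_step {α : Type*} [Fintype α] [DecidableEq α] (z : α → ℝ) (hz : ∀ i, 0 ≤ z i)
    (A : Finset α) (k : α) (hk : k ∉ A) (i : α) :
    ∑ π : Equiv.Perm α, (∏ j ∈ A, z (π j)) * z (π k) ≤
      ∑ π : Equiv.Perm α, (∏ j ∈ A, z (π j)) * z (π i) := by
  by_cases hi : i ∈ A
  · have hswap : ∑ π : Equiv.Perm α, (∏ j ∈ A.erase i, z (π j)) * (z (π i) * z (π i)) =
        ∑ π : Equiv.Perm α, (∏ j ∈ A.erase i, z (π j)) * (z (π k) * z (π k)) := by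
      rw [← Equiv.sum_comp (Equiv.mulRight (Equiv.swap i k))]
      refine Finset.sum_congr rfl fun π _ => ?_
      simp only [Equiv.coe_mulRight, Equiv.Perm.mul_apply, Equiv.swap_apply_left]
      congr 1
      refine Finset.prod_congr rfl fun j hj => ?_
      rw [Equiv.swap_apply_of_ne_of_ne]
      · exact Finset.ne_of_mem_erase hj
      · rintro rfl; exact hk (Finset.mem_of_mem_erase hj)
    have e1 : ∀ (π : Equiv.Perm α), ∏ j ∈ A, z (π j) = (∏ j ∈ A.erase i, z (π j)) * z (π i) :=
      fun π => (Finset.prod_erase_mul A (fun j => z (π j)) hi).symm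
    simp only [e1]
    have key : ∑ π : Equiv.Perm α, 2 * ((∏ j ∈ A.erase i, z (π j)) * z (π i) * z (π k)) ≤
        ∑ π : Equiv.Perm α, ((∏ j ∈ A.erase i, z (π j)) * (z (π i) * z (π i)) +
          (∏ j ∈ A.erase i, z (π j)) * (z (π k) * z (π k))) := by
      refine Finset.sum_le_sum fun π _ => ?_
      have hq : 0 ≤ ∏ j ∈ A.erase i, z (π j) := Finset.prod_nonneg fun j _ => hz _
      nlinarith [mul_nonneg hq (sq_nonneg (z (π i) - z (π k)))]
    rw [Finset.sum_add_distrib, ← hswap, ← Finset.mul_sum] at key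
    have : ∑ π : Equiv.Perm α, (∏ j ∈ A.erase i, z (π j)) * (z (π i) * z (π i)) =
      ∑ π : Equiv.Perm α, (∏ j ∈ A.erase i, z (π j)) * z (π i) * z (π i) :=
      Finset.sum_congr rfl fun π _ => by ring
    linarith
  · apply le_of_eq
    rw [← Equiv.sum_comp (Equiv.mulRight (Equiv.swap i k))]
    refine Finset.sum_congr rfl fun π _ => ?_
    simp only [Equiv.coe_mulRight, Equiv.Perm.mul_apply, Equiv.swap_apply_right]
    congr 1
    refine Finset.prod_congr rfl fun j hj => ?_
    rw [Equiv.swap_apply_of_ne_of_ne]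
    · rintro rfl; exact hi hj
    · rintro rfl; exact hk hj

lemma aux_perm {α : Type*} [Fintype α] [DecidableEq α] [Nonempty α] (z : α → ℝ)
    (hz : ∀ i, 0 ≤ z i) (K : ℝ) (hK : ∑ i, z i ≤ Fintype.card α * K) (A : Finset α) :
    ∑ π : Equiv.Perm α, ∏ j ∈ A, z (π j) ≤ Fintype.card (Equiv.Perm α) * K ^ A.card := by
  have hc : (0 : ℝ) < Fintype.card α := by exact_mod_cast Fintype.card_pos
  have hK0 : 0 ≤ K := by
    have : 0 ≤ ∑ i, z i := Finset.sum_nonneg fun i _ => hz i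
    by_contra h
    push Not at h
    nlinarith
  induction A using Finset.induction_on with
  | empty => simp
  | insert k A hk ih =>
    have h1 : (Fintype.card α : ℝ) * ∑ π : Equiv.Perm α, (∏ j ∈ A, z (π j)) * z (π k) ≤
        (∑ π : Equiv.Perm α, ∏ j ∈ A, z (π j)) * ∑ i, z i := by
      calc _ = ∑ i : α, ∑ π : Equiv.Perm α, (∏ j ∈ A, z (π j)) * z (π k) := by simp
        _ ≤ ∑ i : α, ∑ π : Equiv.Perm α, (∏ j ∈ A, z (π j)) * z (π i) :=
            Finset.sum_le_sum fun i _ => aux_step z hz A k hk i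
        _ = _ := by
            rw [Finset.sum_comm, Finset.sum_mul]
            refine Finset.sum_congr rfl fun π _ => ?_
            rw [← Finset.mul_sum, Equiv.sum_comp π z]
    have h2 : (∑ π : Equiv.Perm α, ∏ j ∈ A, z (π j)) * ∑ i, z i ≤
        (Fintype.card (Equiv.Perm α) * K ^ A.card) * (Fintype.card α * K) :=
      mul_le_mul ih hK (Finset.sum_nonneg fun i _ => hz i) (by positivity)
    have e : ∀ π : Equiv.Perm α, ∏ j ∈ insert k A, z (π j) = (∏ j ∈ A, z (π j)) * z (π k) :=
      fun π => by rw [Finset.prod_insert hk, mul_comm]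
    simp only [e]
    rw [Finset.card_insert_of_notMem hk, pow_succ]
    refine le_of_mul_le_mul_left ?_ hc
    calc _ ≤ _ := h1
      _ ≤ _ := h2
      _ = _ := by ring

lemma aux_ext {p m : ℕ} (ι σ : Fin m ↪ Fin p) :
    ∃ π : Equiv.Perm (Fin p), ∀ j, π (ι j) = σ j := by
  let e : {x // x ∈ Set.range ι} ≃ {x // x ∈ Set.range σ} :=
    (Equiv.ofInjective ι ι.injective).symm.trans (Equiv.ofInjective σ σ.injective)
  classical
  refine ⟨e.extendSubtype, fun j => ?_⟩
  rw [Equiv.extendSubtype_apply_of_mem e (ι j) ⟨j, rfl⟩]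
  have : (⟨ι j, ⟨j, rfl⟩⟩ : {x // x ∈ Set.range ι}) = Equiv.ofInjective ι ι.injective j := rfl
  simp only [e, Equiv.trans_apply]
  rw [this, Equiv.symm_apply_apply]
  rfl

lemma aux_emb {p m : ℕ} (ι : Fin m ↪ Fin p) (f : (Fin m ↪ Fin p) → ℝ) :
    (Fintype.card (Equiv.Perm (Fin p)) : ℝ) * ∑ σ, f σ =
      Fintype.card (Fin m ↪ Fin p) * ∑ π : Equiv.Perm (Fin p), f (ι.trans π.toEmbedding) := by
  have h1 : ∀ τ : Equiv.Perm (Fin p), ∑ σ, f σ = ∑ σ : Fin m ↪ Fin p, f (σ.trans τ.toEmbedding) := by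
    intro τ
    exact (Equiv.sum_comp (Equiv.embeddingCongr (Equiv.refl (Fin m)) τ) f).symm
  have h2 : ∀ σ : Fin m ↪ Fin p, ∑ π : Equiv.Perm (Fin p), f (ι.trans π.toEmbedding) =
      ∑ τ : Equiv.Perm (Fin p), f (σ.trans τ.toEmbedding) := by
    intro σ
    obtain ⟨π0, h0⟩ := aux_ext ι σ
    rw [← Equiv.sum_comp (Equiv.mulRight π0)]
    refine Finset.sum_congr rfl fun τ _ => ?_
    congr 1
    ext j
    simp [h0]
  calc _ = ∑ τ : Equiv.Perm (Fin p), ∑ σ, f σ := by simp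
    _ = ∑ τ : Equiv.Perm (Fin p), ∑ σ : Fin m ↪ Fin p, f (σ.trans τ.toEmbedding) :=
      Finset.sum_congr rfl fun τ _ => h1 τ
    _ = ∑ σ : Fin m ↪ Fin p, ∑ τ : Equiv.Perm (Fin p), f (σ.trans τ.toEmbedding) :=
      Finset.sum_comm
    _ = ∑ σ : Fin m ↪ Fin p, ∑ π : Equiv.Perm (Fin p), f (ι.trans π.toEmbedding) :=
      Finset.sum_congr rfl fun σ _ => (h2 σ).symm
    _ = _ := by simp

lemma aux_sample {p m : ℕ} (hp : 0 < p) (hmp : m ≤ p) (z : Fin p → ℝ)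
    (hz : ∀ i, 0 ≤ z i) (K : ℝ) (hK : ∑ i, z i ≤ p * K) :
    ∑ σ : Fin m ↪ Fin p, ∏ j, z (σ j) ≤ Fintype.card (Fin m ↪ Fin p) * K ^ m := by
  have : Nonempty (Fin p) := ⟨⟨0, hp⟩⟩
  have hP : (0 : ℝ) < Fintype.card (Equiv.Perm (Fin p)) := by exact_mod_cast Fintype.card_pos
  let ι : Fin m ↪ Fin p := Fin.castLEEmb hmp
  have h := aux_emb ι (fun σ => ∏ j, z (σ j))
  have h2 := aux_perm z hz K (by simpa using hK) (Finset.univ.map ι)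
  simp only [Finset.prod_map, Finset.card_map, Finset.card_univ, Fintype.card_fin] at h2
  refine le_of_mul_le_mul_left ?_ hP
  rw [h]
  calc _ ≤ (Fintype.card (Fin m ↪ Fin p) : ℝ) * (Fintype.card (Equiv.Perm (Fin p)) * K ^ m) :=
        mul_le_mul_of_nonneg_left h2 (by positivity)
    _ = _ := by ring

lemma aux_chord (s t : ℝ) (h0 : 0 ≤ t) (h1 : t ≤ 1) :
    Real.exp (s * t) ≤ 1 + t * (Real.exp s - 1) := by
  have := convexOn_exp.2 (Set.mem_univ (0 : ℝ)) (Set.mem_univ s) (sub_nonneg.2 h1) h0 (by ring)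
  simp only [smul_eq_mul, mul_zero, zero_add, Real.exp_zero] at this
  rw [mul_comm s t]
  linarith

open Classical in
lemma aux_chernoff {p m : ℕ} (hp : 0 < p) (hmp : m ≤ p) (a : Fin p → ℝ) (N M s c β : ℝ)
    (hN : 0 < N) (hM : 0 < M) (hβ : 1 < β) (hm : 4 * M * Real.log β ≤ m)
    (ha : ∀ i, 0 ≤ a i) (hab : ∀ i, a i ≤ M * N / p) (hs : ∑ i, a i = N)
    (hg : 1 / 4 ≤ s * c - (Real.exp s - 1)) :
    (((Finset.univ : Finset (Fin m ↪ Fin p)).filter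
      (fun σ => s * (c * (m * N / p)) ≤ s * ∑ j, a (σ j))).card : ℝ) ≤
      Fintype.card (Fin m ↪ Fin p) * β⁻¹ := by
  have hp' : (0 : ℝ) < p := by exact_mod_cast hp
  set b := M * N / p with hb
  have hb0 : 0 < b := by positivity
  set z : Fin p → ℝ := fun i => Real.exp (s * (a i / b)) with hzdef
  have hzs : ∑ i, z i ≤ p * Real.exp ((Real.exp s - 1) / M) := by
    calc ∑ i, z i ≤ ∑ i, (1 + a i / b * (Real.exp s - 1)) :=
          Finset.sum_le_sum fun i _ => aux_chord s _ (div_nonneg (ha i) hb0.le)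
            ((div_le_one hb0).2 (hab i))
      _ = p * ((Real.exp s - 1) / M + 1) := by
          rw [Finset.sum_add_distrib, ← Finset.sum_mul, ← Finset.sum_div, hs, hb]
          simp
          field_simp
          ring
      _ ≤ _ := mul_le_mul_of_nonneg_left (Real.add_one_le_exp _) hp'.le
  have h1 := aux_sample hp hmp z (fun i => (Real.exp_pos _).le) _ hzs
  set B := (Finset.univ : Finset (Fin m ↪ Fin p)).filter
      (fun σ => s * (c * (m * N / p)) ≤ s * ∑ j, a (σ j)) with hB
  have h2 : (B.card : ℝ) * Real.exp (s * c * (m / M)) ≤ ∑ σ : Fin m ↪ Fin p, ∏ j, z (σ j) := by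
    calc _ = ∑ σ ∈ B, Real.exp (s * c * (m / M)) := by simp
      _ ≤ ∑ σ ∈ B, ∏ j, z (σ j) := by
          refine Finset.sum_le_sum fun σ hσ => ?_
          simp only [hB, Finset.mem_filter, Finset.mem_univ, true_and] at hσ
          simp only [hzdef]
          rw [← Real.exp_sum, Real.exp_le_exp, ← Finset.mul_sum, ← Finset.sum_div, ← mul_div_assoc s,
            le_div_iff₀ hb0]
          refine le_trans (le_of_eq ?_) hσ
          rw [hb]; field_simp
      _ ≤ _ := Finset.sum_le_sum_of_subset_of_nonneg (Finset.subset_univ _)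
            fun σ _ _ => Finset.prod_nonneg fun j _ => (Real.exp_pos _).le
  have h3 : (B.card : ℝ) * Real.exp (s * c * (m / M)) ≤
      Fintype.card (Fin m ↪ Fin p) * Real.exp ((Real.exp s - 1) * (m / M)) := by
    refine h2.trans (h1.trans (le_of_eq ?_))
    rw [← Real.exp_nat_mul]
    congr 2; ring
  have hmM : 4 * Real.log β ≤ m / M := by
    rw [le_div_iff₀ hM]; linarith
  have hl : 0 < Real.log β := Real.log_pos hβ
  have h4 : Real.exp ((Real.exp s - 1) * (m / M)) ≤ β⁻¹ * Real.exp (s * c * (m / M)) := by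
    have : β⁻¹ = Real.exp (- Real.log β) := by
      rw [Real.exp_neg, Real.exp_log (by linarith)]
    rw [this, ← Real.exp_add, Real.exp_le_exp]
    nlinarith
  refine le_of_mul_le_mul_right ?_ (Real.exp_pos (s * c * (m / M)))
  calc _ ≤ _ := h3
    _ ≤ (Fintype.card (Fin m ↪ Fin p) : ℝ) * (β⁻¹ * Real.exp (s * c * (m / M))) :=
        mul_le_mul_of_nonneg_left h4 (by positivity)
    _ = _ := by ring

lemma aux_mgf {p : ℕ} (c : Fin p → ℝ) :
    ∑ ω : Fin p → Bool, Real.exp (∑ l, c l * signVec ω l) ≤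
      2 ^ p * Real.exp ((∑ l, c l ^ 2) / 2) := by
  have h : ∑ ω : Fin p → Bool, Real.exp (∑ l, c l * signVec ω l) =
      ∏ l, ∑ b : Bool, Real.exp (c l * (if b then 1 else -1)) := by
    rw [Finset.prod_univ_sum, Fintype.piFinset_univ]
    refine Finset.sum_congr rfl fun ω _ => ?_
    rw [Real.exp_sum]
    rfl
  rw [h]
  calc _ ≤ ∏ l : Fin p, 2 * Real.exp (c l ^ 2 / 2) := by
        refine Finset.prod_le_prod (fun l _ => Finset.sum_nonneg fun b _ => (Real.exp_pos _).le)
          fun l _ => ?_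
        have := Real.cosh_le_exp_half_sq (c l)
        rw [Real.cosh_eq] at this
        simp
        linarith
    _ = _ := by
        rw [Finset.prod_mul_distrib, ← Real.exp_sum, Finset.sum_div]
        simp

open Classical in
lemma aux_tail {p : ℕ} (hp : 0 < p) (c : Fin p → ℝ) (N M : ℝ) (hN : 0 < N) (hM : 0 < M)
    (hc : ∑ l, c l ^ 2 = N / p) :
    (((Finset.univ : Finset (Fin p → Bool)).filter
      (fun ω => M * N / p < (∑ l, c l * signVec ω l) ^ 2)).card : ℝ) ≤
      2 * 2 ^ p * Real.exp (- M / 2) := by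
  have hp' : (0 : ℝ) < p := by exact_mod_cast hp
  set t := Real.sqrt (M * N / p) with ht
  have ht2 : t ^ 2 = M * N / p := Real.sq_sqrt (by positivity)
  have ht0 : 0 ≤ t := Real.sqrt_nonneg _
  set θ := p * t / N with hθ
  have hθ0 : 0 ≤ θ := by positivity
  have hθt : θ * t = M := by
    rw [hθ, div_mul_eq_mul_div, mul_assoc, ← sq, ht2]; field_simp
  have hθ2 : θ ^ 2 * (N / p) = M := by
    rw [hθ, div_pow, mul_pow, ht2]; field_simp
  set B := (Finset.univ : Finset (Fin p → Bool)).filter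
      (fun ω => M * N / p < (∑ l, c l * signVec ω l) ^ 2) with hB
  have g1 := aux_mgf (fun l => θ * c l)
  have g2 := aux_mgf (fun l => -θ * c l)
  have e1 : ∑ l, (θ * c l) ^ 2 = M := by
    simp only [mul_pow]; rw [← Finset.mul_sum, hc, hθ2]
  have e2 : ∑ l, (-θ * c l) ^ 2 = M := by
    simp only [mul_pow, neg_sq]; rw [← Finset.mul_sum, hc, hθ2]
  rw [e1] at g1
  rw [e2] at g2
  simp only [mul_assoc, ← Finset.mul_sum] at g1 g2
  have key : (B.card : ℝ) * Real.exp M ≤ 2 * 2 ^ p * Real.exp (M / 2) := by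
    calc _ = ∑ ω ∈ B, Real.exp M := by simp
      _ ≤ ∑ ω ∈ B, (Real.exp (θ * ∑ l, c l * signVec ω l) +
            Real.exp (-θ * ∑ l, c l * signVec ω l)) := by
          refine Finset.sum_le_sum fun ω hω => ?_
          simp only [hB, Finset.mem_filter, Finset.mem_univ, true_and] at hω
          rw [← ht2] at hω
          have := sq_lt_sq.1 hω
          rw [abs_of_nonneg ht0, lt_abs] at this
          rcases this with h | h
          · have : Real.exp M ≤ Real.exp (θ * ∑ l, c l * signVec ω l) := by
              rw [Real.exp_le_exp, ← hθt]; exact mul_le_mul_of_nonneg_left h.le hθ0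
            linarith [Real.exp_pos (-θ * ∑ l, c l * signVec ω l)]
          · have : Real.exp M ≤ Real.exp (-θ * ∑ l, c l * signVec ω l) := by
              rw [Real.exp_le_exp, ← hθt]
              nlinarith [mul_le_mul_of_nonneg_left h.le hθ0]
            linarith [Real.exp_pos (θ * ∑ l, c l * signVec ω l)]
      _ ≤ ∑ ω, (Real.exp (θ * ∑ l, c l * signVec ω l) +
            Real.exp (-θ * ∑ l, c l * signVec ω l)) :=
          Finset.sum_le_sum_of_subset_of_nonneg (Finset.subset_univ _)
            fun ω _ _ => by positivity
      _ ≤ _ := by rw [Finset.sum_add_distrib]; linarith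
  have : Real.exp (M / 2) = Real.exp (-M / 2) * Real.exp M := by
    rw [← Real.exp_add]; congr 1; ring
  rw [this] at key
  refine le_of_mul_le_mul_right ?_ (Real.exp_pos M)
  linarith

/-- preservation of pairwise distances under the structured
dimension-reduction map `x ↦ √(p/m)·Rᵀ H D x`: if
`4(√β + √(8 log(βp)))² log β ≤ m ≤ p` with `β > 1`, then with probability at least
`1 − 3β⁻¹`, `0.40‖x₁−x₂‖₂ ≤ ‖√(p/m)·Rᵀ H D (x₁−x₂)‖₂ ≤ 1.48‖x₁−x₂‖₂`. -/
theorem stmt_14 (p m : ℕ) (hp : 0 < p) (hmp : m ≤ p) (x₁ x₂ : Fin p → ℝ)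
    (H : Matrix (Fin p) (Fin p) ℝ) (hHorth : Hᵀ * H = 1)
    (hH : ∀ j l, |H j l| = 1 / Real.sqrt p)
    (β : ℝ) (hβ : 1 < β)
    (hcond : 4 * (Real.sqrt β + Real.sqrt (8 * Real.log (β * p))) ^ 2 * Real.log β ≤ m) :
    probOf {ω : (Fin p → Bool) × (Fin m ↪ Fin p) |
        0.40 * l2norm (x₁ - x₂) ≤
            l2norm (Real.sqrt ((p : ℝ) / m) •
              (((sampMatrix ω.2)ᵀ * H * signMatrix ω.1) *ᵥ (x₁ - x₂))) ∧
          l2norm (Real.sqrt ((p : ℝ) / m) •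
              (((sampMatrix ω.2)ᵀ * H * signMatrix ω.1) *ᵥ (x₁ - x₂))) ≤
            1.48 * l2norm (x₁ - x₂)} ≥ 1 - 3 * β⁻¹ := by
  classical
  have hp' : (0 : ℝ) < p := by exact_mod_cast hp
  have hE : 0 < Fintype.card (Fin m ↪ Fin p) :=
    Fintype.card_pos_iff.2 ⟨Fin.castLEEmb hmp⟩
  have hE' : (0 : ℝ) < Fintype.card (Fin m ↪ Fin p) := by exact_mod_cast hE
  -- small β is trivial
  by_cases hβ3 : β ≤ 3
  · have h1 : 1 - 3 * β⁻¹ ≤ 0 := by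
      have : 1 ≤ 3 * β⁻¹ := by
        rw [← div_eq_mul_inv, le_div_iff₀ (by linarith)]; linarith
      linarith
    refine le_trans h1 ?_
    unfold probOf
    positivity
  push Not at hβ3
  have hβ0 : 0 < β := by linarith
  set v := x₁ - x₂ with hv
  set M := (Real.sqrt β + Real.sqrt (8 * Real.log (β * p))) ^ 2 with hM
  set L := Real.log (β * p) with hL
  have hL0 : 0 ≤ L := by
    apply Real.log_nonneg
    have : (1 : ℝ) ≤ p := by exact_mod_cast hp
    nlinarith
  have hM1 : 3 + 8 * L ≤ M := by
    have h1 := Real.sq_sqrt hβ0.le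
    have h2 := Real.sq_sqrt (show (0 : ℝ) ≤ 8 * L by positivity)
    have h3 := Real.sqrt_nonneg β
    have h4 := Real.sqrt_nonneg (8 * L)
    rw [hM]; nlinarith [mul_nonneg h3 h4]
  have hM0 : 0 < M := by linarith
  have hlogβ : 0 < Real.log β := Real.log_pos hβ
  have hm0 : (0 : ℝ) < m := lt_of_lt_of_le (by positivity) hcond
  set N := ∑ l, v l ^ 2 with hNdef
  set y : (Fin p → Bool) → Fin p → ℝ := fun ω i => ∑ l, (H i l * v l) * signVec ω l with hy
  have hsgn : ∀ (ω : Fin p → Bool) l, signVec ω l ^ 2 = 1 := by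
    intro ω l; unfold signVec; split_ifs <;> norm_num
  have hform : ∀ ω : (Fin p → Bool) × (Fin m ↪ Fin p),
      l2norm (Real.sqrt ((p : ℝ) / m) • (((sampMatrix ω.2)ᵀ * H * signMatrix ω.1) *ᵥ v)) =
        Real.sqrt ((p : ℝ) / m * ∑ j, y ω.1 (ω.2 j) ^ 2) := by
    intro ω
    unfold l2norm
    congr 1
    rw [Finset.mul_sum]
    refine Finset.sum_congr rfl fun j _ => ?_
    have : ((((sampMatrix ω.2)ᵀ * H * signMatrix ω.1) *ᵥ v)) j = y ω.1 (ω.2 j) := by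
      simp only [hy, Matrix.mulVec, dotProduct, signMatrix, Matrix.mul_diagonal]
      refine Finset.sum_congr rfl fun l _ => ?_
      have : ((sampMatrix ω.2)ᵀ * H) j l = H (ω.2 j) l := by
        simp [Matrix.mul_apply, sampMatrix]
      rw [this]; ring
    rw [Pi.smul_apply, this, smul_eq_mul, mul_pow, Real.sq_sqrt (by positivity)]
  have hysum : ∀ ω, ∑ i, y ω i ^ 2 = N := by
    intro ω
    set u : Fin p → ℝ := fun l => v l * signVec ω l with hu
    have e1 : ∀ i, y ω i = (H *ᵥ u) i := by
      intro i
      simp only [hy, Matrix.mulVec, dotProduct, hu]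
      exact Finset.sum_congr rfl fun l _ => by ring
    have e2 : ∑ i, y ω i ^ 2 = (H *ᵥ u) ⬝ᵥ (H *ᵥ u) := by
      simp only [dotProduct, e1, sq]
    rw [e2, Matrix.dotProduct_mulVec, ← Matrix.mulVec_transpose, Matrix.mulVec_mulVec, hHorth,
      Matrix.one_mulVec]
    simp only [dotProduct, hNdef, hu]
    refine Finset.sum_congr rfl fun l _ => ?_
    have := hsgn ω l
    linear_combination (v l ^ 2) * this
  have hN0 : 0 ≤ N := Finset.sum_nonneg fun l _ => sq_nonneg _
  set G : Set ((Fin p → Bool) × (Fin m ↪ Fin p)) := {ω |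
        0.40 * l2norm v ≤
            l2norm (Real.sqrt ((p : ℝ) / m) •
              (((sampMatrix ω.2)ᵀ * H * signMatrix ω.1) *ᵥ v)) ∧
          l2norm (Real.sqrt ((p : ℝ) / m) •
              (((sampMatrix ω.2)ᵀ * H * signMatrix ω.1) *ᵥ v)) ≤
            1.48 * l2norm v} with hG
  have hGmem : ∀ ω : (Fin p → Bool) × (Fin m ↪ Fin p),
      0.16 * (m * N / p) ≤ ∑ j, y ω.1 (ω.2 j) ^ 2 →
      ∑ j, y ω.1 (ω.2 j) ^ 2 ≤ 2.19 * (m * N / p) → ω ∈ G := by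
    intro ω h1 h2
    have hl : l2norm v = Real.sqrt N := rfl
    rw [hG, Set.mem_ofPred_eq, hform ω, hl]
    have e : ∀ c : ℝ, (p : ℝ) / m * (c * (m * N / p)) = c * N := by
      intro c; field_simp
    have h1' := mul_le_mul_of_nonneg_left h1 (show (0 : ℝ) ≤ p / m by positivity)
    have h2' := mul_le_mul_of_nonneg_left h2 (show (0 : ℝ) ≤ p / m by positivity)
    rw [e] at h1' h2'
    constructor
    · apply Real.le_sqrt_of_sq_le
      rw [mul_pow, Real.sq_sqrt hN0]
      refine le_trans (le_of_eq ?_) h1'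
      norm_num
    · rw [Real.sqrt_le_left (by positivity), mul_pow, Real.sq_sqrt hN0]
      nlinarith
  rcases hN0.eq_or_lt with hNz | hNpos
  · have hyz : ∀ ω i, y ω i ^ 2 = 0 := by
      intro ω i
      have := hysum ω
      rw [← hNz] at this
      exact (Finset.sum_eq_zero_iff_of_nonneg (fun i _ => sq_nonneg _)).1 this i (Finset.mem_univ i)
    have hall : G = Set.univ := by
      ext ω
      simp only [Set.mem_univ, iff_true]
      apply hGmem <;> simp only [hyz, ← hNz] <;> simp
    rw [hall]
    unfold probOf
    rw [Set.ncard_univ, Nat.card_eq_fintype_card, div_self]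
    · have : 0 < β⁻¹ := by positivity
      linarith
    · rw [Fintype.card_prod]
      have : (0 : ℝ) < Fintype.card (Fin p → Bool) := by exact_mod_cast Fintype.card_pos
      push_cast
      positivity
  -- the incoherence event
  set B1 : Finset (Fin p → Bool) :=
    Finset.univ.filter (fun ω => ∃ i, M * N / p < y ω i ^ 2) with hB1
  have hB1card : (B1.card : ℝ) ≤ 2 ^ p * β⁻¹ := by
    have hsub : B1 ⊆ Finset.univ.biUnion (fun i : Fin p =>
        (Finset.univ : Finset (Fin p → Bool)).filter (fun ω => M * N / p < y ω i ^ 2)) := by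
      intro ω hω
      simpa [hB1] using hω
    have h1 : (B1.card : ℝ) ≤ ∑ i : Fin p, (((Finset.univ : Finset (Fin p → Bool)).filter
        (fun ω => M * N / p < y ω i ^ 2)).card : ℝ) := by
      exact_mod_cast (Finset.card_le_card hsub).trans Finset.card_biUnion_le
    have h2 : ∀ i : Fin p, (((Finset.univ : Finset (Fin p → Bool)).filter
        (fun ω => M * N / p < y ω i ^ 2)).card : ℝ) ≤ 2 * 2 ^ p * Real.exp (-M / 2) := by
      intro i
      apply aux_tail hp (fun l => H i l * v l) N M hNpos hM0
      rw [hNdef, Finset.sum_div]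
      refine Finset.sum_congr rfl fun l _ => ?_
      have : H i l ^ 2 = 1 / p := by
        rw [← sq_abs, hH, div_pow, Real.sq_sqrt hp'.le]; simp
      rw [mul_pow, this]; ring
    have h3 : (B1.card : ℝ) ≤ p * (2 * 2 ^ p * Real.exp (-M / 2)) := by
      refine h1.trans ((Finset.sum_le_sum fun i _ => h2 i).trans (le_of_eq ?_))
      simp
    have h4 : Real.exp (-M / 2) ≤ (2 * (β * p))⁻¹ := by
      have : (2 * (β * p))⁻¹ = Real.exp (-(Real.log 2 + L)) := by
        rw [Real.exp_neg, Real.exp_add, Real.exp_log (by norm_num), Real.exp_log (by positivity)]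
      rw [this, Real.exp_le_exp]
      have := Real.log_two_lt_d9
      linarith
    calc (B1.card : ℝ) ≤ _ := h3
      _ ≤ p * (2 * 2 ^ p * (2 * (β * p))⁻¹) := by gcongr
      _ = _ := by field_simp
  -- the sampling event
  have hsamp : ∀ ω, ω ∉ B1 →
      (((Finset.univ : Finset (Fin m ↪ Fin p)).filter (fun σ => (ω, σ) ∉ G)).card : ℝ) ≤
        Fintype.card (Fin m ↪ Fin p) * (2 * β⁻¹) := by
    intro ω hω
    have hab : ∀ i, y ω i ^ 2 ≤ M * N / p := by
      simpa [hB1] using hω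
    have hc' : 4 * M * Real.log β ≤ m := hcond
    have hlg := Real.log_two_gt_d9
    have hll := Real.log_two_lt_d9
    have c1 := aux_chernoff hp hmp (fun i => y ω i ^ 2) N M (Real.log 2) 2.19 β hNpos hM0 hβ hc'
      (fun i => sq_nonneg _) hab (hysum ω) (by
        rw [Real.exp_log (by norm_num)]; linarith)
    have c2 := aux_chernoff hp hmp (fun i => y ω i ^ 2) N M (-Real.log 2) 0.16 β hNpos hM0 hβ hc'
      (fun i => sq_nonneg _) hab (hysum ω) (by
        rw [Real.exp_neg, Real.exp_log (by norm_num)]; linarith)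
    have hsub : (Finset.univ : Finset (Fin m ↪ Fin p)).filter (fun σ => (ω, σ) ∉ G) ⊆
        (Finset.univ.filter (fun σ : Fin m ↪ Fin p => Real.log 2 * (2.19 * (m * N / p)) ≤
          Real.log 2 * ∑ j, y ω (σ j) ^ 2)) ∪
        (Finset.univ.filter (fun σ : Fin m ↪ Fin p => -Real.log 2 * (0.16 * (m * N / p)) ≤
          -Real.log 2 * ∑ j, y ω (σ j) ^ 2)) := by
      intro σ hσ
      simp only [Finset.mem_filter, Finset.mem_univ, true_and, Finset.mem_union] at hσ ⊢
      by_contra hcon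
      rw [not_or, not_le, not_le] at hcon
      apply hσ
      apply hGmem
      · show 0.16 * (m * N / p) ≤ ∑ j, y ω (σ j) ^ 2
        have := hcon.2
        rw [neg_mul, neg_mul, neg_lt_neg_iff] at this
        exact (lt_of_mul_lt_mul_left this (by linarith)).le
      · show ∑ j, y ω (σ j) ^ 2 ≤ 2.19 * (m * N / p)
        exact (lt_of_mul_lt_mul_left hcon.1 (by linarith)).le
    have hcard := Nat.cast_le (α := ℝ).2
      ((Finset.card_le_card hsub).trans (Finset.card_union_le _ _))
    push_cast at hcard
    linarith
  -- counting
  have hcompl : (Gᶜ.ncard : ℝ) ≤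
      2 ^ p * (Fintype.card (Fin m ↪ Fin p) : ℝ) * (3 * β⁻¹) := by
    have e1 : (Gᶜ.ncard : ℝ) = ∑ ω : Fin p → Bool,
        (((Finset.univ : Finset (Fin m ↪ Fin p)).filter (fun σ => (ω, σ) ∉ G)).card : ℝ) := by
      rw [Set.ncard_eq_toFinset_card']
      have : Gᶜ.toFinset = Finset.univ.filter (fun ω => ω ∉ G) := by ext; simp
      rw [this, Finset.card_filter, Fintype.sum_prod_type]
      push_cast
      simp only [Finset.card_filter]
      push_cast
      rfl
    rw [e1]
    calc _ ≤ ∑ ω : Fin p → Bool, ((if ω ∈ B1 then (Fintype.card (Fin m ↪ Fin p) : ℝ) else 0) +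
          Fintype.card (Fin m ↪ Fin p) * (2 * β⁻¹)) := by
          refine Finset.sum_le_sum fun ω _ => ?_
          split_ifs with h
          · have : (((Finset.univ : Finset (Fin m ↪ Fin p)).filter
                (fun σ => (ω, σ) ∉ G)).card : ℝ) ≤ Fintype.card (Fin m ↪ Fin p) := by
              exact_mod_cast Finset.card_le_univ _
            have h2 : 0 ≤ (Fintype.card (Fin m ↪ Fin p) : ℝ) * (2 * β⁻¹) := by positivity
            linarith
          · rw [zero_add]; exact hsamp ω h
      _ = B1.card * (Fintype.card (Fin m ↪ Fin p) : ℝ) +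
            2 ^ p * (Fintype.card (Fin m ↪ Fin p) * (2 * β⁻¹)) := by
          rw [Finset.sum_add_distrib, Finset.sum_ite_mem, Finset.univ_inter, Finset.sum_const,
            Finset.sum_const, nsmul_eq_mul, nsmul_eq_mul, Finset.card_univ (α := Fin p → Bool)]
          simp only [Fintype.card_fun, Fintype.card_bool, Fintype.card_fin]
          push_cast
          rfl
      _ ≤ (2 ^ p * β⁻¹) * (Fintype.card (Fin m ↪ Fin p) : ℝ) +
            2 ^ p * (Fintype.card (Fin m ↪ Fin p) * (2 * β⁻¹)) := by gcongr
      _ = _ := by ring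
  have htot : (G.ncard : ℝ) + Gᶜ.ncard = 2 ^ p * (Fintype.card (Fin m ↪ Fin p) : ℝ) := by
    have := Set.ncard_add_ncard_compl G
    rw [Nat.card_eq_fintype_card, Fintype.card_prod] at this
    simp only [Fintype.card_fun, Fintype.card_bool, Fintype.card_fin] at this
    exact_mod_cast this
  unfold probOf
  have hc : (Fintype.card ((Fin p → Bool) × (Fin m ↪ Fin p)) : ℝ) =
      2 ^ p * (Fintype.card (Fin m ↪ Fin p) : ℝ) := by
    rw [Fintype.card_prod]
    simp only [Fintype.card_fun, Fintype.card_bool, Fintype.card_fin]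
    push_cast
    rfl
  rw [ge_iff_le, hc, le_div_iff₀ (by positivity)]
  linarith
end

section
/- Let x₁,…,x_n ∈ ℝ^p, let 2 ≤ m ≤ p, and let R₁,…,R_n ∈ ℝ^{p×m} be independent sampling matrices (each consisting of m distinct canonical basis vectors of ℝ^p chosen uniformly at random without replacement). Define Ĉ_emp = (p(p−1)/(m(m−1)))·(1/n)·Σ_{i=1}^n R_i R_iᵀ x_i x_iᵀ R_i R_iᵀ and C_emp = (1/n)·Σ_{i=1}^n x_i x_iᵀ. Then E[Ĉ_emp] = C_emp + ((p−m)/(m−1))·diag(C_emp). -/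
open Matrix Finset

/-- Indicator that coordinate `a` is sampled by `σ`. -/
noncomputable def sInd {p m : ℕ} (σ : Fin m ↪ Fin p) (a : Fin p) : ℝ :=
  ∑ j, if σ j = a then 1 else 0

lemma sInd_eq {p m : ℕ} (σ : Fin m ↪ Fin p) (a : Fin p) :
    sInd σ a = if a ∈ Set.range σ then 1 else 0 := by
  classical
  unfold sInd
  split_ifs with h
  · obtain ⟨j, rfl⟩ := h
    simp
  · refine Finset.sum_eq_zero fun j _ => if_neg fun hj => h ⟨j, hj⟩

lemma sInd_sq {p m : ℕ} (σ : Fin m ↪ Fin p) (a : Fin p) :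
    sInd σ a * sInd σ a = sInd σ a := by
  rw [sInd_eq]; split_ifs <;> simp

lemma sInd_sum {p m : ℕ} (σ : Fin m ↪ Fin p) : ∑ a, sInd σ a = m := by
  unfold sInd
  rw [Finset.sum_comm]
  simp

lemma samp_mul {p m : ℕ} (σ : Fin m ↪ Fin p) :
    sampMatrix σ * (sampMatrix σ)ᵀ = Matrix.diagonal (sInd σ) := by
  ext a b
  simp only [Matrix.mul_apply, sampMatrix, Matrix.transpose_apply, Matrix.of_apply,
    Matrix.diagonal_apply]
  split_ifs with h
  · subst h
    unfold sInd
    refine Finset.sum_congr rfl fun j _ => ?_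
    split_ifs <;> simp
  · refine Finset.sum_eq_zero fun j _ => ?_
    split_ifs with h1 h2
    · exact absurd (h1.symm.trans h2) h
    all_goals simp

lemma sInd_trans {p m : ℕ} (σ : Fin m ↪ Fin p) (π : Equiv.Perm (Fin p)) (a : Fin p) :
    sInd (σ.trans π.toEmbedding) (π a) = sInd σ a := by
  simp [sInd]

lemma pair_invariant {p n m : ℕ} (i : Fin n) (π : Equiv.Perm (Fin p)) (a b : Fin p) :
    ∑ ω : Fin n → (Fin m ↪ Fin p), sInd (ω i) (π a) * sInd (ω i) (π b) =
      ∑ ω : Fin n → (Fin m ↪ Fin p), sInd (ω i) a * sInd (ω i) b := by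
  symm
  refine Fintype.sum_equiv
    (Equiv.piCongrRight fun _ => Equiv.embeddingCongr (Equiv.refl (Fin m)) π) _ _ fun ω => ?_
  have h : (Equiv.piCongrRight fun _ => Equiv.embeddingCongr (Equiv.refl (Fin m)) π) ω i
      = (ω i).trans π.toEmbedding := by
    ext j; simp
  rw [h, sInd_trans, sInd_trans]

lemma pair_diag {p n m : ℕ} (i : Fin n) (a : Fin p) :
    (p : ℝ) * ∑ ω : Fin n → (Fin m ↪ Fin p), sInd (ω i) a * sInd (ω i) a =
      (Fintype.card (Fin n → (Fin m ↪ Fin p)) : ℝ) * m := by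
  have h : ∀ b : Fin p, ∑ ω : Fin n → (Fin m ↪ Fin p), sInd (ω i) b * sInd (ω i) b =
      ∑ ω : Fin n → (Fin m ↪ Fin p), sInd (ω i) a * sInd (ω i) a := fun b => by
    have := pair_invariant (m := m) i (Equiv.swap a b) a a
    simpa only [Equiv.swap_apply_left] using this
  have h2 : ∑ b : Fin p, ∑ ω : Fin n → (Fin m ↪ Fin p), sInd (ω i) b * sInd (ω i) b =
      (Fintype.card (Fin n → (Fin m ↪ Fin p)) : ℝ) * m := by
    rw [Finset.sum_comm]
    simp_rw [sInd_sq, sInd_sum]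
    rw [Finset.sum_const, nsmul_eq_mul, Finset.card_univ]
  rw [← h2, Finset.sum_congr rfl fun b _ => h b, Finset.sum_const, nsmul_eq_mul]
  simp

lemma pair_off {p n m : ℕ} (i : Fin n) (a b : Fin p) (hab : a ≠ b) :
    ((p : ℝ) - 1) * ∑ ω : Fin n → (Fin m ↪ Fin p), sInd (ω i) a * sInd (ω i) b =
      ((m : ℝ) - 1) * ∑ ω : Fin n → (Fin m ↪ Fin p), sInd (ω i) a * sInd (ω i) a := by
  have h : ∀ d ∈ Finset.univ.erase a,
      ∑ ω : Fin n → (Fin m ↪ Fin p), sInd (ω i) a * sInd (ω i) d =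
      ∑ ω : Fin n → (Fin m ↪ Fin p), sInd (ω i) a * sInd (ω i) b := fun d hd => by
    have := pair_invariant (m := m) i (Equiv.swap b d) a b
    rwa [Equiv.swap_apply_left,
      Equiv.swap_apply_of_ne_of_ne hab (Finset.ne_of_mem_erase hd).symm] at this
  have h2 : ∑ d : Fin p, ∑ ω : Fin n → (Fin m ↪ Fin p), sInd (ω i) a * sInd (ω i) d =
      (m : ℝ) * ∑ ω : Fin n → (Fin m ↪ Fin p), sInd (ω i) a * sInd (ω i) a := by
    rw [Finset.sum_comm]
    simp_rw [← Finset.mul_sum, sInd_sum, sInd_sq]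
    rw [← Finset.sum_mul, mul_comm]
  rw [← Finset.add_sum_erase _ _ (Finset.mem_univ a), Finset.sum_congr rfl h,
    Finset.sum_const, nsmul_eq_mul, Finset.card_erase_of_mem (Finset.mem_univ a),
    Finset.card_univ, Fintype.card_fin, Nat.cast_sub (Nat.one_le_of_lt a.pos)] at h2
  push_cast at h2
  linarith

/-- bias of the rescaled empirical covariance of the subsampled data:
`E[Ĉ_emp] = C_emp + ((p−m)/(m−1))·diag(C_emp)` where
`Ĉ_emp = (p(p−1)/(m(m−1)))·(1/n)·Σᵢ Rᵢ Rᵢᵀ xᵢ xᵢᵀ Rᵢ Rᵢᵀ` and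
`C_emp = (1/n)·Σᵢ xᵢ xᵢᵀ`. -/
theorem stmt_15 (p n m : ℕ) (hm : 2 ≤ m) (hmp : m ≤ p)
    (x : Fin n → Fin p → ℝ) :
    expec (fun ω : Fin n → (Fin m ↪ Fin p) =>
        (((p : ℝ) * ((p : ℝ) - 1)) / ((m : ℝ) * ((m : ℝ) - 1))) •
          ((n : ℝ)⁻¹ • ∑ i,
            (sampMatrix (ω i) * (sampMatrix (ω i))ᵀ) * Matrix.vecMulVec (x i) (x i) *
              (sampMatrix (ω i) * (sampMatrix (ω i))ᵀ))) =
      (n : ℝ)⁻¹ • ∑ i, Matrix.vecMulVec (x i) (x i) +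
        (((p : ℝ) - m) / ((m : ℝ) - 1)) •
          diagPart ((n : ℝ)⁻¹ • ∑ i, Matrix.vecMulVec (x i) (x i)) := by
  have hm' : (2 : ℝ) ≤ m := by exact_mod_cast hm
  have hp' : (m : ℝ) ≤ p := by exact_mod_cast hmp
  have hm0 : (m : ℝ) ≠ 0 := by linarith
  have hm1 : (m : ℝ) - 1 ≠ 0 := by linarith
  have hp0 : (p : ℝ) ≠ 0 := by linarith
  have hp1 : (p : ℝ) - 1 ≠ 0 := by linarith
  have hne : Nonempty (Fin n → (Fin m ↪ Fin p)) := ⟨fun _ => Fin.castLEEmb hmp⟩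
  have hN : (Fintype.card (Fin n → (Fin m ↪ Fin p)) : ℝ) ≠ 0 := by
    exact_mod_cast Fintype.card_ne_zero
  ext a b
  simp only [expec, samp_mul, diagPart, Matrix.smul_apply, Matrix.add_apply, Matrix.sum_apply,
    Matrix.mul_diagonal, Matrix.diagonal_mul, Matrix.diagonal_apply, Matrix.diag_apply,
    Matrix.vecMulVec_apply, smul_eq_mul]
  simp_rw [← Finset.mul_sum]
  rw [Finset.sum_comm]
  have key : ∀ i : Fin n, ∑ ω : Fin n → (Fin m ↪ Fin p),
      sInd (ω i) a * (x i a * x i b) * sInd (ω i) b =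
      (∑ ω : Fin n → (Fin m ↪ Fin p), sInd (ω i) a * sInd (ω i) b) * (x i a * x i b) := by
    intro i
    rw [Finset.sum_mul]
    exact Finset.sum_congr rfl fun ω _ => by ring
  simp_rw [key]
  generalize hNd : (Fintype.card (Fin n → (Fin m ↪ Fin p)) : ℝ) = N at *
  by_cases hab : a = b
  · subst hab
    have hc : ∀ i : Fin n, ∑ ω : Fin n → (Fin m ↪ Fin p), sInd (ω i) a * sInd (ω i) a =
        N * m / p := fun i => by
      rw [eq_div_iff hp0, ← hNd, ← pair_diag i a, mul_comm]
    simp_rw [hc]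
    rw [← Finset.mul_sum, if_pos trivial]
    generalize (n : ℝ)⁻¹ = t
    field_simp
    ring
  · have hc : ∀ i : Fin n, ∑ ω : Fin n → (Fin m ↪ Fin p), sInd (ω i) a * sInd (ω i) b =
        N * m * (m - 1) / (p * (p - 1)) := fun i => by
      rw [eq_div_iff (mul_ne_zero hp0 hp1), ← hNd, ← pair_diag i a]
      linear_combination (p : ℝ) * pair_off (m := m) i a b hab
    simp_rw [hc]
    rw [← Finset.mul_sum, if_neg hab]
    generalize (n : ℝ)⁻¹ = t
    field_simp
    ring
end
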